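/- (Corollary 1: sufficiently noisy smoothing ensures increased overlap relative to the base, unsmoothed policy.) Let d ≥ 1, let (𝒜, Σ) be a measurable space, and let p be a Markov kernel from ℝ^d to 𝒜. Let γ = N(0, I_d) be the standard Gaussian measure on ℝ^d and M_d = ∫ ‖w‖ dγ(w). Fix two contexts c, c' ∈ ℝ^d and set Δ = c − c'. Suppose the pair (c, c') satisfies the identifiability lower bound TV(p(·|c), p(·|c')) ≥ m · ‖Δ‖ for some m > 0. If σ ≥ M_d / m, then, with p_σ denoting the Gaussian context-smoothed kernel p_σ(A|c) = ∫ p(A | c + σ·w) dγ(w), smoothing reduces total variation and hence increases overlap: TV(p_σ(·|c), p_σ(·|c')) ≤ TV(p(·|c), p(·|c')), or equivalently Ov(p_σ(·|c), p_σ(·|c')) ≥ Ov(p(·|c), p(·|c')). -/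

import Mathlib

open MeasureTheory Real

/-- The standard Gaussian measure `N(0, I_d)` on `ℝ^d`, given by its density
`(2π)^{-d/2} exp(-‖w‖²/2)` with respect to Lebesgue measure. -/
noncomputable def stdGaussian (d : ℕ) : Measure (EuclideanSpace ℝ (Fin d)) :=
  (volume : Measure (EuclideanSpace ℝ (Fin d))).withDensity
    (fun w => ENNReal.ofReal ((2 * π) ^ (-(d : ℝ) / 2) * Real.exp (-‖w‖ ^ 2 / 2)))

/-- Total variation distance: `TV(P,Q) = sup_{A measurable} |P(A) − Q(A)|`. -/
noncomputable def TV {𝒜 : Type*} [MeasurableSpace 𝒜] (P Q : Measure 𝒜) : ℝ :=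
  ⨆ A : {A : Set 𝒜 // MeasurableSet A}, |(P A.1).toReal - (Q A.1).toReal|

/-- The Gaussian context-smoothed kernel `p_σ(·|c) = ∫ p(· | c + σ·w) dγ(w)`, as a
measure on the action space, for each context `c`. -/
noncomputable def smoothedKernel (d : ℕ) (σ : ℝ) {𝒜 : Type*} [MeasurableSpace 𝒜]
    (p : ProbabilityTheory.Kernel (EuclideanSpace ℝ (Fin d)) 𝒜)
    (c : EuclideanSpace ℝ (Fin d)) : Measure 𝒜 :=
  (stdGaussian d).bind (fun w => p (c + σ • w))

/-- Overlap between two probability measures: `Ov(P,Q) = 1 − TV(P,Q)`. -/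
noncomputable def Ov {𝒜 : Type*} [MeasurableSpace 𝒜] (P Q : Measure 𝒜) : ℝ :=
  1 - TV P Q

/-- The density of the standard Gaussian measure on `ℝ^d`. -/
noncomputable def gaussianDensity (d : ℕ) (w : EuclideanSpace ℝ (Fin d)) : ℝ :=
  (2 * π) ^ (-(d : ℝ) / 2) * Real.exp (-‖w‖ ^ 2 / 2)

/-- The `L¹` modulus of continuity of translation is controlled by the gradient. -/
theorem lintegral_enorm_sub_translate_le {E : Type*} [NormedAddCommGroup E] [NormedSpace ℝ E]
    [FiniteDimensional ℝ E] [MeasurableSpace E] [BorelSpace E] (μ : Measure E)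
    [μ.IsAddHaarMeasure] {φ : E → ℝ} (hφ : ContDiff ℝ 1 φ) (h : E) :
    ∫⁻ v, ‖φ (v + h) - φ v‖ₑ ∂μ ≤ ‖h‖ₑ * ∫⁻ v, ‖fderiv ℝ φ v‖ₑ ∂μ := by
  have hcont : Continuous (fderiv ℝ φ) := hφ.continuous_fderiv (by simp)
  have hpoint (v : E) : ‖φ (v + h) - φ v‖ₑ ≤
      ∫⁻ t in Set.Ioc (0 : ℝ) 1, ‖h‖ₑ * ‖fderiv ℝ φ (v + t • h)‖ₑ := by
    have hderiv (t : ℝ) : HasDerivAt (fun s : ℝ => φ (v + s • h)) (fderiv ℝ φ (v + t • h) h) t := by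
      have h1 : HasDerivAt (fun s : ℝ => v + s • h) h t := by
        simpa using ((hasDerivAt_id t).smul_const h).const_add v
      exact ((hφ.differentiable (by simp)) _).hasFDerivAt.comp_hasDerivAt t h1
    have hftc := intervalIntegral.integral_eq_sub_of_hasDerivAt (a := 0) (b := 1)
      (fun t _ => hderiv t) (Continuous.intervalIntegrable (by fun_prop) _ _)
    simp only [one_smul, zero_smul, add_zero] at hftc
    rw [← hftc, intervalIntegral.integral_of_le zero_le_one]
    refine (enorm_integral_le_lintegral_enorm _).trans (lintegral_mono fun t => ?_)
    rw [mul_comm]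
    exact ContinuousLinearMap.le_opENorm _ _
  calc ∫⁻ v, ‖φ (v + h) - φ v‖ₑ ∂μ
      ≤ ∫⁻ v, (∫⁻ t in Set.Ioc (0 : ℝ) 1, ‖h‖ₑ * ‖fderiv ℝ φ (v + t • h)‖ₑ) ∂μ :=
        lintegral_mono hpoint
    _ = ∫⁻ t in Set.Ioc (0 : ℝ) 1, ∫⁻ v, ‖h‖ₑ * ‖fderiv ℝ φ (v + t • h)‖ₑ ∂μ := by
        refine lintegral_lintegral_swap (Measurable.aemeasurable (Continuous.measurable ?_))
        have : Continuous fun x : E × ℝ => ‖fderiv ℝ φ (x.1 + x.2 • h)‖ₑ := by fun_prop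
        exact (ENNReal.continuous_const_mul enorm_ne_top).comp this
    _ = ‖h‖ₑ * ∫⁻ v, ‖fderiv ℝ φ v‖ₑ ∂μ := by
        have (t : ℝ) : ∫⁻ v, ‖h‖ₑ * ‖fderiv ℝ φ (v + t • h)‖ₑ ∂μ =
            ‖h‖ₑ * ∫⁻ v, ‖fderiv ℝ φ v‖ₑ ∂μ := by
          rw [lintegral_const_mul' _ _ enorm_ne_top,
            lintegral_add_right_eq_self (fun v => ‖fderiv ℝ φ v‖ₑ)]
        simp [this]

theorem gaussianDensity_nonneg (d : ℕ) (w : EuclideanSpace ℝ (Fin d)) :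
    0 ≤ gaussianDensity d w := by
  unfold gaussianDensity; positivity

theorem contDiff_gaussianDensity (d : ℕ) : ContDiff ℝ 1 (gaussianDensity d) := by
  have : ContDiff ℝ 1 fun w : EuclideanSpace ℝ (Fin d) => ‖w‖ ^ 2 := contDiff_norm_sq ℝ
  unfold gaussianDensity
  fun_prop

theorem norm_fderiv_gaussianDensity (d : ℕ) (w : EuclideanSpace ℝ (Fin d)) :
    ‖fderiv ℝ (gaussianDensity d) w‖ = gaussianDensity d w * ‖w‖ := by
  have h1 : HasFDerivAt (fun w : EuclideanSpace ℝ (Fin d) => ‖w‖ ^ 2) (2 • innerSL ℝ w) w :=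
    (hasStrictFDerivAt_norm_sq w).hasFDerivAt
  have h2 : HasFDerivAt (gaussianDensity d) (-(gaussianDensity d w) • innerSL ℝ w) w := by
    have := (((h1.const_mul (-1 / 2 : ℝ)).exp).const_mul ((2 * π) ^ (-(d : ℝ) / 2)))
    have hfun : gaussianDensity d =
        fun y => (2 * π) ^ (-(d : ℝ) / 2) * Real.exp (-1 / 2 * ‖y‖ ^ 2) := by
      ext v
      simp only [gaussianDensity]
      ring_nf
    rw [hfun]
    refine this.congr_fderiv ?_
    ext v
    simp
    ring
  rw [h2.fderiv, norm_smul, innerSL_apply_norm, norm_neg, Real.norm_of_nonneg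
    (gaussianDensity_nonneg d w)]

theorem integrable_exp_neg_mul_norm_sq (d : ℕ) {b : ℝ} (hb : 0 < b) :
    Integrable fun w : EuclideanSpace ℝ (Fin d) => Real.exp (-b * ‖w‖ ^ 2) := by
  have := (GaussianFourier.integrable_cexp_neg_mul_sq_norm_add (b := (b : ℂ)) (by simpa using hb) 0
    (0 : EuclideanSpace ℝ (Fin d))).norm
  simpa [Complex.norm_exp, ← Complex.ofReal_pow] using this

theorem integrable_gaussianDensity (d : ℕ) : Integrable (gaussianDensity d) := by
  refine ((integrable_exp_neg_mul_norm_sq d (b := 1 / 2) (by norm_num)).const_mul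
    ((2 * π) ^ (-(d : ℝ) / 2))).congr (Filter.Eventually.of_forall fun w => ?_)
  simp only [gaussianDensity]
  ring_nf

theorem integrable_gaussianDensity_mul_norm (d : ℕ) :
    Integrable fun w => gaussianDensity d w * ‖w‖ := by
  refine ((integrable_exp_neg_mul_norm_sq d (b := 1 / 4) (by norm_num)).const_mul
    ((2 * π) ^ (-(d : ℝ) / 2))).mono'
    ((contDiff_gaussianDensity d).continuous.mul continuous_norm).aestronglyMeasurable
    (Filter.Eventually.of_forall fun w => ?_)
  rw [Real.norm_of_nonneg (mul_nonneg (gaussianDensity_nonneg d w) (norm_nonneg w)),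
    gaussianDensity, mul_assoc]
  gcongr
  have h1 : ‖w‖ ≤ Real.exp (1 / 4 * ‖w‖ ^ 2) := by
    nlinarith [Real.add_one_le_exp (1 / 4 * ‖w‖ ^ 2), sq_nonneg (1 - ‖w‖ / 2)]
  calc Real.exp (-‖w‖ ^ 2 / 2) * ‖w‖
      ≤ Real.exp (-‖w‖ ^ 2 / 2) * Real.exp (1 / 4 * ‖w‖ ^ 2) := by gcongr
    _ = Real.exp (-(1 / 4) * ‖w‖ ^ 2) := by rw [← Real.exp_add]; ring_nf

theorem stdGaussian_eq_withDensity (d : ℕ) :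
    stdGaussian d = volume.withDensity fun w => ENNReal.ofReal (gaussianDensity d w) := rfl

theorem measurable_ofReal_gaussianDensity (d : ℕ) :
    Measurable fun w => ENNReal.ofReal (gaussianDensity d w) :=
  (contDiff_gaussianDensity d).continuous.measurable.ennreal_ofReal

instance isFiniteMeasure_stdGaussian (d : ℕ) : IsFiniteMeasure (stdGaussian d) := by
  rw [stdGaussian_eq_withDensity]
  exact isFiniteMeasure_withDensity_ofReal (integrable_gaussianDensity d).2

theorem integral_norm_stdGaussian (d : ℕ) :
    ∫ w, ‖w‖ ∂(stdGaussian d) = ∫ w, gaussianDensity d w * ‖w‖ := by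
  rw [stdGaussian_eq_withDensity, integral_withDensity_eq_integral_toReal_smul
    (measurable_ofReal_gaussianDensity d) (by simp)]
  simp [gaussianDensity_nonneg]

theorem lintegral_enorm_gaussianDensity_sub_le (d : ℕ) (a a' : EuclideanSpace ℝ (Fin d)) :
    ∫⁻ v, ‖gaussianDensity d (v - a) - gaussianDensity d (v - a')‖ₑ ≤
      ENNReal.ofReal (‖a - a'‖ * ∫ w, ‖w‖ ∂(stdGaussian d)) := by
  have hgrad : ∫⁻ v, ‖fderiv ℝ (gaussianDensity d) v‖ₑ =
      ENNReal.ofReal (∫ w, ‖w‖ ∂(stdGaussian d)) := by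
    rw [integral_norm_stdGaussian, ofReal_integral_eq_lintegral_ofReal
      (integrable_gaussianDensity_mul_norm d) (Filter.Eventually.of_forall fun w =>
        mul_nonneg (gaussianDensity_nonneg d w) (norm_nonneg w))]
    simp_rw [← norm_fderiv_gaussianDensity, ofReal_norm]
  have key := lintegral_enorm_sub_translate_le volume (contDiff_gaussianDensity d) (a' - a)
  rw [hgrad, ← lintegral_sub_right_eq_self _ a', ← ofReal_norm, norm_sub_rev,
    ← ENNReal.ofReal_mul (norm_nonneg _)] at key
  simpa using key

section Smoothing

variable {d : ℕ} {σ : ℝ} {𝒜 : Type*} [MeasurableSpace 𝒜]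
  (p : ProbabilityTheory.Kernel (EuclideanSpace ℝ (Fin d)) 𝒜)

theorem smoothedKernel_apply (c : EuclideanSpace ℝ (Fin d)) {A : Set 𝒜} (hA : MeasurableSet A) :
    smoothedKernel d σ p c A = ∫⁻ w, p (c + σ • w) A ∂(stdGaussian d) :=
  Measure.bind_apply hA (p.measurable.comp (by fun_prop)).aemeasurable

theorem smoothedKernel_apply_eq_lintegral_translate (hσ : σ ≠ 0) (c : EuclideanSpace ℝ (Fin d))
    {A : Set 𝒜} (hA : MeasurableSet A) :
    smoothedKernel d σ p c A =
      ∫⁻ v, ENNReal.ofReal (gaussianDensity d (v - σ⁻¹ • c)) * p (σ • v) A := by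
  have hmeas : Measurable fun w => p (c + σ • w) A := (p.measurable_coe hA).comp (by fun_prop)
  rw [smoothedKernel_apply p c hA, stdGaussian_eq_withDensity,
    lintegral_withDensity_eq_lintegral_mul _ (measurable_ofReal_gaussianDensity d) hmeas,
    ← lintegral_sub_right_eq_self _ (σ⁻¹ • c)]
  simp [smul_sub, smul_smul, hσ]

variable [ProbabilityTheory.IsMarkovKernel p]

theorem smoothedKernel_apply_ne_top (c : EuclideanSpace ℝ (Fin d)) {A : Set 𝒜}
    (hA : MeasurableSet A) : smoothedKernel d σ p c A ≠ ⊤ := by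
  rw [smoothedKernel_apply p c hA]
  refine ne_top_of_le_ne_top (measure_ne_top (stdGaussian d) Set.univ) ?_
  calc ∫⁻ w, p (c + σ • w) A ∂(stdGaussian d) ≤ ∫⁻ _, 1 ∂(stdGaussian d) :=
        lintegral_mono fun _ => prob_le_one
    _ = stdGaussian d Set.univ := by simp

theorem smoothedKernel_apply_le_add (hσ : 0 < σ) (c c' : EuclideanSpace ℝ (Fin d))
    {A : Set 𝒜} (hA : MeasurableSet A) :
    smoothedKernel d σ p c A ≤ smoothedKernel d σ p c' A +
      ENNReal.ofReal (‖c - c'‖ * (∫ w, ‖w‖ ∂(stdGaussian d)) / σ) := by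
  have hbound := lintegral_enorm_gaussianDensity_sub_le d (σ⁻¹ • c) (σ⁻¹ • c')
  rw [← smul_sub, norm_smul, norm_inv, Real.norm_of_nonneg hσ.le, mul_assoc, mul_comm,
    ← div_eq_mul_inv] at hbound
  rw [smoothedKernel_apply_eq_lintegral_translate p hσ.ne' c hA,
    smoothedKernel_apply_eq_lintegral_translate p hσ.ne' c' hA]
  have hmeas : Measurable fun v : EuclideanSpace ℝ (Fin d) =>
      ‖gaussianDensity d (v - σ⁻¹ • c) - gaussianDensity d (v - σ⁻¹ • c')‖ₑ := by
    have := (contDiff_gaussianDensity d).continuous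
    exact Continuous.measurable (by fun_prop)
  refine le_trans ?_ (add_le_add_right hbound _)
  rw [← lintegral_add_right _ hmeas]
  refine lintegral_mono fun v => ?_
  set x := gaussianDensity d (v - σ⁻¹ • c)
  set y := gaussianDensity d (v - σ⁻¹ • c')
  have hxy : ENNReal.ofReal x ≤ ENNReal.ofReal y + ‖x - y‖ₑ := by
    rw [← ofReal_norm, ← ENNReal.ofReal_add (gaussianDensity_nonneg d _) (norm_nonneg _)]
    exact ENNReal.ofReal_le_ofReal (by linarith [Real.le_norm_self (x - y)])
  calc ENNReal.ofReal x * p (σ • v) A ≤ (ENNReal.ofReal y + ‖x - y‖ₑ) * p (σ • v) A := by gcongr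
    _ = ENNReal.ofReal y * p (σ • v) A + ‖x - y‖ₑ * p (σ • v) A := add_mul _ _ _
    _ ≤ ENNReal.ofReal y * p (σ • v) A + ‖x - y‖ₑ := by
        gcongr
        exact mul_le_of_le_one_right' prob_le_one

/-- Gaussian smoothing makes the kernel Lipschitz in total variation. -/
theorem TV_smoothedKernel_le (hσ : 0 < σ) (c c' : EuclideanSpace ℝ (Fin d)) :
    TV (smoothedKernel d σ p c) (smoothedKernel d σ p c') ≤
      ‖c - c'‖ * (∫ w, ‖w‖ ∂(stdGaussian d)) / σ := by
  have hM : 0 ≤ ∫ w, ‖w‖ ∂(stdGaussian d) := integral_nonneg fun w => norm_nonneg w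
  have hone (a a' : EuclideanSpace ℝ (Fin d)) {A : Set 𝒜} (hA : MeasurableSet A) :
      (smoothedKernel d σ p a A).toReal ≤ (smoothedKernel d σ p a' A).toReal +
        ‖a - a'‖ * (∫ w, ‖w‖ ∂(stdGaussian d)) / σ := by
    have hfin := smoothedKernel_apply_ne_top (σ := σ) p a' hA
    have := ENNReal.toReal_mono (by finiteness) (smoothedKernel_apply_le_add p hσ a a' hA)
    rwa [ENNReal.toReal_add hfin ENNReal.ofReal_ne_top,
      ENNReal.toReal_ofReal (by positivity)] at this
  have : Nonempty {A : Set 𝒜 // MeasurableSet A} := ⟨⟨∅, MeasurableSet.empty⟩⟩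
  refine ciSup_le fun A => abs_sub_le_iff.2 ⟨?_, ?_⟩
  · linarith [hone c c' A.2]
  · have := hone c' c A.2
    rw [norm_sub_rev] at this
    linarith

end Smoothing

/-- **Corollary 1.** If the pair of contexts `(c, c')` satisfies the identifiability lower
bound `TV(p(·|c), p(·|c')) ≥ m · ‖c − c'‖` for some `m > 0`, and the noise level satisfies
`σ ≥ M_d / m`, then smoothing reduces total variation and hence increases overlap relative
to the base, unsmoothed policy. -/
theorem sufficiently_noisy_smoothing_increases_overlap
    (d : ℕ) (hd : 1 ≤ d) {𝒜 : Type*} [MeasurableSpace 𝒜]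
    (p : ProbabilityTheory.Kernel (EuclideanSpace ℝ (Fin d)) 𝒜)
    [ProbabilityTheory.IsMarkovKernel p]
    (M : ℝ) (hM : M = ∫ w, ‖w‖ ∂(stdGaussian d))
    (c c' : EuclideanSpace ℝ (Fin d)) (m : ℝ) (hm : 0 < m)
    (h_ident : TV (p c) (p c') ≥ m * ‖c - c'‖)
    (σ : ℝ) (hσ : 0 < σ) (hσ_noisy : σ ≥ M / m) :
    TV (smoothedKernel d σ p c) (smoothedKernel d σ p c') ≤ TV (p c) (p c') ∧
    Ov (smoothedKernel d σ p c) (smoothedKernel d σ p c') ≥ Ov (p c) (p c') := by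
  have hTV : TV (smoothedKernel d σ p c) (smoothedKernel d σ p c') ≤ TV (p c) (p c') := by
    refine (TV_smoothedKernel_le p hσ c c').trans (le_trans ?_ h_ident)
    rw [← hM, div_le_iff₀ hσ]
    have : M ≤ σ * m := (div_le_iff₀ hm).1 hσ_noisy
    nlinarith [mul_le_mul_of_nonneg_left this (norm_nonneg (c - c'))]
  exact ⟨hTV, sub_le_sub_left hTV 1⟩
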